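/- arXiv:2003.12967 — 2 statements merged into one kernel-verified Lean document; each statement's English description precedes it below -/
import Mathlib

section
/- Let τ > 0, λ ∈ ℝ, let f : [0,1] → ℂ be continuous, and let η : [0,1] → ℂ be differentiable with η′(ρ) + iτλ·η(ρ) = τ·f(ρ) for all ρ ∈ [0,1]. Then ∫₀¹|η(ρ)|²dρ ≤ 2|η(0)|² + 2τ²∫₀¹|f(ξ)|²dξ. -/
open Set

/-- Cauchy–Schwarz on the unit interval, against the constant function `1`. -/
theorem sq_intervalIntegral_le_intervalIntegral_sq {h : ℝ → ℝ} (hh : ContinuousOn h (Icc 0 1)) :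
    (∫ x in (0:ℝ)..1, h x) ^ 2 ≤ ∫ x in (0:ℝ)..1, h x ^ 2 := by
  have hi : IntervalIntegrable h MeasureTheory.volume 0 1 :=
    hh.intervalIntegrable_of_Icc zero_le_one
  have hi2 : IntervalIntegrable (fun x => h x ^ 2) MeasureTheory.volume 0 1 :=
    (hh.pow 2).intervalIntegrable_of_Icc zero_le_one
  set m := ∫ x in (0:ℝ)..1, h x with hm
  have hnonneg : 0 ≤ ∫ x in (0:ℝ)..1, (h x - m) ^ 2 :=
    intervalIntegral.integral_nonneg zero_le_one fun x _ => sq_nonneg _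
  have hexp : ∫ x in (0:ℝ)..1, (h x - m) ^ 2 = (∫ x in (0:ℝ)..1, h x ^ 2) - 2 * m * m + m ^ 2 := by
    have : (fun x => (h x - m) ^ 2) = fun x => h x ^ 2 - 2 * m * h x + m ^ 2 := by
      funext x; ring
    rw [this, intervalIntegral.integral_add (hi2.sub (hi.const_mul _)) (by simp),
      intervalIntegral.integral_sub hi2 (hi.const_mul _), intervalIntegral.integral_const_mul, ← hm]
    simp
  nlinarith

/-- Pointwise bound for `η' = τ f - iτλ η`: the zeroth-order term only rotates the phase. -/
theorem norm_le_of_hasDerivAt_rotation {τ lam : ℝ} (hτ : 0 < τ) {f η : ℝ → ℂ}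
    (hf : ContinuousOn f (Icc 0 1))
    (hη : ∀ ρ ∈ Icc (0:ℝ) 1,
      HasDerivAt η ((τ : ℂ) * f ρ - Complex.I * (τ : ℂ) * (lam : ℂ) * η ρ) ρ)
    {ρ : ℝ} (hρ : ρ ∈ Icc (0:ℝ) 1) :
    ‖η ρ‖ ≤ ‖η 0‖ + τ * ∫ ξ in (0:ℝ)..1, ‖f ξ‖ := by
  let e : ℝ → ℂ := fun x => Complex.exp (((τ * lam * x : ℝ) : ℂ) * Complex.I)
  have he : ∀ x, ‖e x‖ = 1 := fun x => Complex.norm_exp_ofReal_mul_I _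
  have hec : Continuous e := by fun_prop
  have hed : ∀ x, HasDerivAt e (e x * ((τ : ℂ) * lam * Complex.I)) x := by
    intro x
    have h1 : HasDerivAt (fun y : ℝ => ((τ * lam * y : ℝ) : ℂ) * Complex.I)
        ((τ : ℂ) * lam * Complex.I) x := by
      simpa using (((hasDerivAt_id x).const_mul (τ * lam)).ofReal_comp).mul_const Complex.I
    exact h1.cexp
  have hsub : Icc 0 ρ ⊆ Icc (0:ℝ) 1 := Icc_subset_Icc_right hρ.2
  have hint : ∫ x in (0:ℝ)..ρ, e x * ((τ : ℂ) * f x) = e ρ * η ρ - e 0 * η 0 := by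
    refine intervalIntegral.integral_eq_sub_of_hasDerivAt (f := fun x => e x * η x) ?_ ?_
    · intro x hx
      rw [uIcc_of_le hρ.1] at hx
      refine ((hed x).mul (hη x (hsub hx))).congr_deriv ?_
      ring
    · exact ContinuousOn.intervalIntegrable_of_Icc hρ.1
        (hec.continuousOn.mul (continuousOn_const.mul (hf.mono hsub)))
  have hbound : ‖e ρ * η ρ - e 0 * η 0‖ ≤ τ * ∫ ξ in (0:ℝ)..ρ, ‖f ξ‖ := by
    rw [← hint, ← intervalIntegral.integral_const_mul]
    refine (intervalIntegral.norm_integral_le_integral_norm hρ.1).trans_eq ?_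
    simp [he, abs_of_pos hτ]
  have hmono : ∫ ξ in (0:ℝ)..ρ, ‖f ξ‖ ≤ ∫ ξ in (0:ℝ)..1, ‖f ξ‖ :=
    intervalIntegral.integral_mono_interval le_rfl hρ.1 hρ.2
      (Filter.Eventually.of_forall fun _ => norm_nonneg _)
      (hf.norm.intervalIntegrable_of_Icc zero_le_one)
  have htri := norm_sub_norm_le (e ρ * η ρ) (e 0 * η 0)
  simp only [norm_mul, he, one_mul] at htri
  linarith [mul_le_mul_of_nonneg_left hmono hτ.le]



/-- L² bound for solutions of the delay ODE `η′(ρ) + iτλ η(ρ) = τ f(ρ)`. -/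
theorem stmt_11 (τ lam : ℝ) (hτ : 0 < τ) (f η : ℝ → ℂ)
    (hf : ContinuousOn f (Icc 0 1))
    (hη : ∀ ρ ∈ Icc (0:ℝ) 1,
      HasDerivAt η ((τ : ℂ) * f ρ - Complex.I * (τ : ℂ) * (lam : ℂ) * η ρ) ρ) :
    (∫ ρ in (0:ℝ)..1, ‖η ρ‖^2) ≤ 2 * ‖η 0‖^2 + 2 * τ^2 * ∫ ξ in (0:ℝ)..1, ‖f ξ‖^2 := by
  set M := 2 * ‖η 0‖^2 + 2 * τ^2 * ∫ ξ in (0:ℝ)..1, ‖f ξ‖^2 with hM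
  have hCS := sq_intervalIntegral_le_intervalIntegral_sq hf.norm
  have hpt : ∀ ρ ∈ Icc (0:ℝ) 1, ‖η ρ‖ ^ 2 ≤ M := by
    intro ρ hρ
    calc ‖η ρ‖ ^ 2 ≤ (‖η 0‖ + τ * ∫ ξ in (0:ℝ)..1, ‖f ξ‖) ^ 2 :=
          pow_le_pow_left₀ (norm_nonneg _) (norm_le_of_hasDerivAt_rotation hτ hf hη hρ) 2
      _ ≤ 2 * ‖η 0‖ ^ 2 + 2 * τ ^ 2 * (∫ ξ in (0:ℝ)..1, ‖f ξ‖) ^ 2 := by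
          linarith [sq_nonneg (‖η 0‖ - τ * ∫ ξ in (0:ℝ)..1, ‖f ξ‖)]
      _ ≤ M := by rw [hM]; gcongr
  have hηc : ContinuousOn η (Icc 0 1) := fun x hx => (hη x hx).continuousAt.continuousWithinAt
  calc ∫ ρ in (0:ℝ)..1, ‖η ρ‖ ^ 2 ≤ ∫ _ in (0:ℝ)..1, M :=
        intervalIntegral.integral_mono_on zero_le_one
          ((hηc.norm.pow 2).intervalIntegrable_of_Icc zero_le_one) (by simp) hpt
    _ = M := by simp
end

section
/- Let a < b be real numbers and let z : [a,b] → ℂ be continuously differentiable. Then |z(a)|² + |z(b)|² ≤ (2/(b−a))∫_a^b|z(x)|²dx + 2∫_a^b|z(x)||z′(x)|dx. (This trace inequality, obtained from an affine multiplier equal to 1 at a and −1 at b, is the basic boundary-term estimate in the piecewise multiplier technique.) -/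
open Set

/-- Trace inequality from the affine multiplier equal to `1` at `a`
and `-1` at `b`. -/
theorem stmt_14 (a b : ℝ) (hab : a < b) (z : ℝ → ℂ)
    (hz : ContDiffOn ℝ 1 z (Icc a b)) :
    ‖z a‖^2 + ‖z b‖^2
      ≤ (2/(b-a)) * (∫ x in a..b, ‖z x‖^2) + 2 * ∫ x in a..b, ‖z x‖ * ‖deriv z x‖ := by
  have hba : 0 < b - a := sub_pos.2 hab
  have hzc : ContinuousOn z (Icc a b) := hz.continuousOn
  have hwc : ContinuousOn (derivWithin z (Icc a b)) (Icc a b) :=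
    hz.continuousOn_derivWithin (uniqueDiffOn_Icc hab) le_rfl
  have hdw : ∀ x ∈ Ioo a b, derivWithin z (Icc a b) x = deriv z x := fun x hx =>
    derivWithin_of_mem_nhds (Icc_mem_nhds hx.1 hx.2)
  have hderiv : ∀ x ∈ Ioo a b, HasDerivAt z (deriv z x) x := fun x hx =>
    ((hz.differentiableOn one_ne_zero).differentiableAt (Icc_mem_nhds hx.1 hx.2)).hasDerivAt
  have hcongr : ∫ x in a..b, ‖z x‖ * ‖deriv z x‖
      = ∫ x in a..b, ‖z x‖ * ‖derivWithin z (Icc a b) x‖ := by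
    simp only [intervalIntegral.integral_of_le hab.le, MeasureTheory.integral_Ioc_eq_integral_Ioo]
    exact MeasureTheory.setIntegral_congr_fun measurableSet_Ioo fun x hx => by
      simp only [hdw x hx]
  have hsq : ContinuousOn (fun x => 2 / (b - a) * ‖z x‖ ^ 2) (Icc a b) := by fun_prop
  have hprod : ContinuousOn (fun x => 2 * (‖z x‖ * ‖derivWithin z (Icc a b) x‖)) (Icc a b) := by
    fun_prop
  have key := intervalIntegral.sub_le_integral_of_hasDeriv_right_of_le hab.le
    (g := fun x => (2 * x - a - b) / (b - a) * ‖z x‖ ^ 2)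
    (g' := fun x => 2 / (b - a) * ‖z x‖ ^ 2
      + (2 * x - a - b) / (b - a) * (2 * inner ℝ (z x) (deriv z x)))
    (φ := fun x => 2 / (b - a) * ‖z x‖ ^ 2 + 2 * (‖z x‖ * ‖derivWithin z (Icc a b) x‖))
    (by fun_prop)
    (fun x hx => by
      have hm : HasDerivAt (fun y : ℝ => (2 * y - a - b) / (b - a)) (2 / (b - a)) x := by
        simpa using ((((hasDerivAt_id x).const_mul 2).sub_const a).sub_const b).div_const (b - a)
      exact (hm.mul (hderiv x hx).norm_sq).hasDerivWithinAt)
    ((hsq.add hprod).integrableOn_Icc)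
    (fun x hx => by
      have hm : |(2 * x - a - b) / (b - a)| ≤ 1 := by
        rw [abs_div, abs_of_pos hba, div_le_one hba, abs_le]
        constructor <;> linarith [hx.1, hx.2]
      have hmul : (2 * x - a - b) / (b - a) * inner ℝ (z x) (deriv z x)
          ≤ 1 * (‖z x‖ * ‖deriv z x‖) :=
        (le_abs_self _).trans <| (abs_mul _ _).trans_le <|
          mul_le_mul hm (abs_real_inner_le_norm _ _) (abs_nonneg _) zero_le_one
      simp only [hdw x hx]
      linarith)
  rw [intervalIntegral.integral_add (hsq.intervalIntegrable_of_Icc hab.le)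
    (hprod.intervalIntegrable_of_Icc hab.le), intervalIntegral.integral_const_mul,
    intervalIntegral.integral_const_mul, ← hcongr] at key
  have ha : (2 * a - a - b) / (b - a) = -1 := by
    rw [div_eq_iff hba.ne']; ring
  have hb : (2 * b - a - b) / (b - a) = 1 := by
    rw [div_eq_iff hba.ne']; ring
  simp only [ha, hb] at key
  linarith
end
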